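/- Let ℓ > 2 be an integer. A partition λ is an (ℓ,0)-JM partition if and only if λ is a generalized ℓ-partition. -/

import Mathlib

/-- Hook length of the box in row `a`, column `b` (0-indexed) of a Young diagram:
the number of boxes `(a, b')` with `b' ≥ b` plus the number of boxes `(a', b)` with `a' > a`. -/
def YoungDiagram.hook (μ : YoungDiagram) (a b : ℕ) : ℕ :=
  (μ.rowLen a - b) + (μ.colLen b - (a + 1))

/-- `μ` is an `(ℓ,0)`-JM partition: there do not exist boxes `(a,b)`, `(a,y)`, `(x,b)` of `μ`
with `ℓ ∣ h_{(a,b)}`, `ℓ ∤ h_{(a,y)}` and `ℓ ∤ h_{(x,b)}`. -/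
def IsJM (ℓ : ℕ) (μ : YoungDiagram) : Prop :=
  ¬ ∃ a b y x : ℕ, (a, b) ∈ μ ∧ (a, y) ∈ μ ∧ (x, b) ∈ μ ∧
      ℓ ∣ μ.hook a b ∧ ¬ ℓ ∣ μ.hook a y ∧ ¬ ℓ ∣ μ.hook x b


/-- Two boxes are adjacent if they share an edge. -/
def CellAdj (u v : ℕ × ℕ) : Prop :=
  (u.1 = v.1 ∧ (u.2 + 1 = v.2 ∨ v.2 + 1 = u.2)) ∨
  (u.2 = v.2 ∧ (u.1 + 1 = v.1 ∨ v.1 + 1 = u.1))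

/-- A set of boxes is connected if any two of its boxes are joined by a chain of boxes of the
set, successive boxes sharing an edge. -/
def ConnectedSet (R : Finset (ℕ × ℕ)) : Prop :=
  ∀ u ∈ R, ∀ v ∈ R,
    Relation.ReflTransGen (fun x y : ℕ × ℕ => x ∈ R ∧ y ∈ R ∧ CellAdj x y) u v

/-- A set of boxes contains no 2×2 square. -/
def NoSquare (R : Finset (ℕ × ℕ)) : Prop :=
  ¬ ∃ i j : ℕ, (i, j) ∈ R ∧ (i + 1, j) ∈ R ∧ (i, j + 1) ∈ R ∧ (i + 1, j + 1) ∈ R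

/-- `R` is an `ℓ`-rim hook of `μ`: a connected set of `ℓ` boxes of `μ` with no 2×2 square,
whose removal from `μ` leaves the Young diagram of a partition. -/
def IsRimHook (ℓ : ℕ) (μ : YoungDiagram) (R : Finset (ℕ × ℕ)) : Prop :=
  R ⊆ μ.cells ∧ R.card = ℓ ∧ (∃ ν : YoungDiagram, ν.cells = μ.cells \ R) ∧
    ConnectedSet R ∧ NoSquare R

/-- A set of boxes all lying in one row. -/
def Horizontal (R : Finset (ℕ × ℕ)) : Prop := ∃ r : ℕ, ∀ c ∈ R, c.1 = r

/-- A set of boxes all lying in one column. -/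
def Vertical (R : Finset (ℕ × ℕ)) : Prop := ∃ r : ℕ, ∀ c ∈ R, c.2 = r

/-- Two sets of boxes are adjacent if some box of one shares an edge with some box of the
other. -/
def AdjSets (R S : Finset (ℕ × ℕ)) : Prop := ∃ u ∈ R, ∃ v ∈ S, CellAdj u v

/-- One step of removing a horizontal or vertical `ℓ`-rim hook. -/
def RemoveHV (ℓ : ℕ) (μ ν : YoungDiagram) : Prop :=
  ∃ R : Finset (ℕ × ℕ), IsRimHook ℓ μ R ∧ (Horizontal R ∨ Vertical R) ∧
    ν.cells = μ.cells \ R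

/-- `λ` is a generalized `ℓ`-partition: for every `μ` obtained from `λ` by successively removing
horizontal or vertical `ℓ`-rim hooks (including `μ = λ`), (1) every `ℓ`-rim hook of `μ` is
horizontal or vertical, and (2) for any vertical (resp. horizontal) `ℓ`-rim hook `R` of `μ` and
any horizontal (resp. vertical) `ℓ`-rim hook `S` of `μ∖R`, `R` and `S` are not adjacent. -/
def IsGenLPartition (ℓ : ℕ) (lam : YoungDiagram) : Prop :=
  ∀ m : YoungDiagram, Relation.ReflTransGen (RemoveHV ℓ) lam m →
    (∀ R : Finset (ℕ × ℕ), IsRimHook ℓ m R → Horizontal R ∨ Vertical R) ∧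
    (∀ R : Finset (ℕ × ℕ), IsRimHook ℓ m R →
      ∀ m' : YoungDiagram, m'.cells = m.cells \ R →
        ∀ S : Finset (ℕ × ℕ), IsRimHook ℓ m' S →
          ((Vertical R ∧ Horizontal S) ∨ (Horizontal R ∧ Vertical S)) → ¬ AdjSets R S)

namespace YoungDiagram

/-- The Young diagram `μ` together with all lattice points outside the positive quadrant. -/
def Ext (μ : YoungDiagram) (i j : ℤ) : Prop :=
  i < 0 ∨ j < 0 ∨ (i.toNat, j.toNat) ∈ μ

theorem ext_natCast {μ : YoungDiagram} {i j : ℕ} : μ.Ext i j ↔ (i, j) ∈ μ := by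
  simp only [Ext, Int.toNat_natCast]
  exact ⟨by rintro (h | h | h) <;> first | exact h | omega, fun h => Or.inr (Or.inr h)⟩

theorem Ext.mono {μ : YoungDiagram} {i j i' j' : ℤ} (h : μ.Ext i j) (hi : i' ≤ i)
    (hj : j' ≤ j) : μ.Ext i' j' := by
  rcases h with h | h | h
  · left; omega
  · right; left; omega
  · right; right
    exact μ.up_left_mem (Int.toNat_le_toNat hi) (Int.toNat_le_toNat hj) h

theorem exists_rim (μ : YoungDiagram) (c : ℤ) :
    ∃ r : ℤ, ∀ i : ℤ, μ.Ext i (i + c) ↔ i < r := by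
  classical
  obtain ⟨r, hr, hmin⟩ := Int.exists_least_of_bdd (P := fun i => ¬ μ.Ext i (i + c))
    ⟨0, fun z hz => by by_contra h; exact hz (Or.inl (by omega))⟩
    ⟨μ.colLen 0 + |c|, by
      have hc := neg_abs_le c
      rintro (h | h | h)
      · have := abs_nonneg c; omega
      · omega
      · have h0 := μ.up_left_mem le_rfl (Nat.zero_le _) h
        rw [mem_iff_lt_colLen] at h0
        have := abs_nonneg c; omega⟩
  refine ⟨r, fun i => ⟨fun h => ?_, fun h => ?_⟩⟩
  · by_contra hi
    exact hr (h.mono (by omega) (by omega))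
  · by_contra hi
    have := hmin i hi
    omega

/-- The row in which the rim of `μ` crosses the diagonal of content `c`: the least `i` such that
`(i, i + c)` lies in the positive quadrant but not in `μ`. -/
noncomputable def rim (μ : YoungDiagram) (c : ℤ) : ℤ := (μ.exists_rim c).choose

theorem ext_iff_lt_rim {μ : YoungDiagram} {i j : ℤ} : μ.Ext i j ↔ i < μ.rim (j - i) := by
  have := (μ.exists_rim (j - i)).choose_spec i
  rwa [add_sub_cancel] at this

theorem mem_iff_lt_rim {μ : YoungDiagram} {i j : ℕ} :
    (i, j) ∈ μ ↔ (i : ℤ) < μ.rim (j - i) := by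
  rw [← ext_natCast, ext_iff_lt_rim]

theorem rim_eq_of_forall {μ : YoungDiagram} {c r : ℤ}
    (h : ∀ i, μ.Ext i (i + c) ↔ i < r) : μ.rim c = r := by
  have h1 := (h (μ.rim c)).symm.trans ext_iff_lt_rim
  have h2 := (h r).symm.trans ext_iff_lt_rim
  simp only [add_sub_cancel_left] at h1 h2
  omega

theorem rim_nonneg (μ : YoungDiagram) (c : ℤ) : 0 ≤ μ.rim c := by
  have h : μ.Ext (-1) (-1 + c) := Or.inl (by omega)
  rw [ext_iff_lt_rim, add_sub_cancel_left] at h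
  omega

theorem rim_add_nonneg (μ : YoungDiagram) (c : ℤ) : 0 ≤ μ.rim c + c := by
  have h : μ.Ext (-1 - c) (-1 - c + c) := Or.inr (Or.inl (by omega))
  rw [ext_iff_lt_rim, add_sub_cancel_left] at h
  omega

theorem rim_succ_le (μ : YoungDiagram) (c : ℤ) : μ.rim (c + 1) ≤ μ.rim c := by
  have h : μ.Ext (μ.rim (c + 1) - 1) (μ.rim (c + 1) - 1 + (c + 1)) := by
    rw [ext_iff_lt_rim, add_sub_cancel_left]; omega
  have := h.mono le_rfl (show μ.rim (c + 1) - 1 + c ≤ _ by omega)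
  rw [ext_iff_lt_rim, add_sub_cancel_left] at this
  omega

theorem rim_le_succ (μ : YoungDiagram) (c : ℤ) : μ.rim c ≤ μ.rim (c + 1) + 1 := by
  have h : μ.Ext (μ.rim c - 1) (μ.rim c - 1 + c) := by
    rw [ext_iff_lt_rim, add_sub_cancel_left]; omega
  have := h.mono (show μ.rim c - 1 - 1 ≤ _ by omega)
    (show μ.rim c - 1 - 1 + (c + 1) ≤ _ by omega)
  rw [ext_iff_lt_rim, add_sub_cancel_left] at this
  omega

theorem rim_antitone (μ : YoungDiagram) : Antitone μ.rim :=
  antitone_int_of_succ_le μ.rim_succ_le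

theorem rim_add_monotone (μ : YoungDiagram) : Monotone fun c => μ.rim c + c :=
  monotone_int_of_le_succ fun c => by have := μ.rim_le_succ c; omega

/-- `μ` has a bead at `k` if its rim makes a vertical step from the diagonal of content `k` to
that of content `k + 1`; otherwise there is a gap at `k`. -/
def Bead (μ : YoungDiagram) (k : ℤ) : Prop := μ.rim k = μ.rim (k + 1) + 1

theorem not_bead_iff {μ : YoungDiagram} {k : ℤ} : ¬ μ.Bead k ↔ μ.rim k = μ.rim (k + 1) := by
  have := μ.rim_succ_le k
  have := μ.rim_le_succ k
  unfold Bead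
  omega

theorem bead_rowLen (μ : YoungDiagram) (a : ℕ) : μ.Bead (μ.rowLen a - a - 1) := by
  have h1 : ¬ μ.Ext a (μ.rowLen a) := by
    rw [ext_natCast, mem_iff_lt_rowLen]; omega
  have h2 : μ.Ext a (μ.rowLen a - 1) := by
    rcases Nat.eq_zero_or_pos (μ.rowLen a) with h | h
    · exact Or.inr (Or.inl (by omega))
    · have : ((μ.rowLen a - 1 : ℕ) : ℤ) = μ.rowLen a - 1 := by omega
      rw [← this, ext_natCast, mem_iff_lt_rowLen]; omega
  rw [ext_iff_lt_rim] at h1 h2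
  have := μ.rim_le_succ (μ.rowLen a - a - 1)
  rw [show (μ.rowLen a : ℤ) - 1 - a = μ.rowLen a - a - 1 by ring] at h2
  unfold Bead
  rw [show (μ.rowLen a : ℤ) - a - 1 + 1 = μ.rowLen a - a by ring] at *
  omega

theorem not_bead_colLen (μ : YoungDiagram) (b : ℕ) : ¬ μ.Bead (b - μ.colLen b) := by
  have h1 : ¬ μ.Ext (μ.colLen b) b := by
    rw [ext_natCast, mem_iff_lt_colLen]; omega
  have h2 : μ.Ext (μ.colLen b - 1) b := by
    rcases Nat.eq_zero_or_pos (μ.colLen b) with h | h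
    · exact Or.inl (by omega)
    · have : ((μ.colLen b - 1 : ℕ) : ℤ) = μ.colLen b - 1 := by omega
      rw [← this, ext_natCast, mem_iff_lt_colLen]; omega
  rw [ext_iff_lt_rim] at h1 h2
  have := μ.rim_succ_le (b - μ.colLen b)
  rw [show (b : ℤ) - (μ.colLen b - 1) = b - μ.colLen b + 1 by ring] at h2
  rw [not_bead_iff]
  omega

theorem Bead.exists_rowLen {μ : YoungDiagram} {k : ℤ} (h : μ.Bead k) :
    ∃ a : ℕ, (μ.rowLen a : ℤ) - a - 1 = k := by
  obtain ⟨a, ha⟩ := Int.eq_ofNat_of_zero_le (μ.rim_nonneg (k + 1))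
  have hk := μ.rim_add_nonneg (k + 1)
  obtain ⟨j, hj⟩ := Int.eq_ofNat_of_zero_le hk
  refine ⟨a, ?_⟩
  unfold Bead at h
  have h1 : ¬ (a, j) ∈ μ := by
    rw [mem_iff_lt_rim, show (j : ℤ) - a = k + 1 by omega]; omega
  rw [mem_iff_lt_rowLen] at h1
  rcases Nat.eq_zero_or_pos j with h0 | h0
  · omega
  · have h2 : (a, j - 1) ∈ μ := by
      rw [mem_iff_lt_rim, show ((j - 1 : ℕ) : ℤ) - a = k by omega]; omega
    rw [mem_iff_lt_rowLen] at h2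
    omega

theorem exists_colLen_of_not_bead {μ : YoungDiagram} {k : ℤ} (h : ¬ μ.Bead k) :
    ∃ b : ℕ, (b : ℤ) - μ.colLen b = k := by
  obtain ⟨a, ha⟩ := Int.eq_ofNat_of_zero_le (μ.rim_nonneg k)
  obtain ⟨j, hj⟩ := Int.eq_ofNat_of_zero_le (μ.rim_add_nonneg k)
  refine ⟨j, ?_⟩
  rw [not_bead_iff] at h
  have h1 : ¬ (a, j) ∈ μ := by
    rw [mem_iff_lt_rim, show (j : ℤ) - a = k by omega]; omega
  rw [mem_iff_lt_colLen] at h1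
  rcases Nat.eq_zero_or_pos a with h0 | h0
  · omega
  · have h2 : (a - 1, j) ∈ μ := by
      rw [mem_iff_lt_rim, show (j : ℤ) - (a - 1 : ℕ) = k + 1 by omega]; omega
    rw [mem_iff_lt_colLen] at h2
    omega

theorem mem_iff_colLen_lt_rowLen {μ : YoungDiagram} {a b : ℕ} :
    (a, b) ∈ μ ↔ (b : ℤ) - μ.colLen b < μ.rowLen a - a - 1 := by
  have h1 : (a, b) ∈ μ ↔ b < μ.rowLen a := mem_iff_lt_rowLen
  have h2 : (a, b) ∈ μ ↔ a < μ.colLen b := mem_iff_lt_colLen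
  by_cases h : (a, b) ∈ μ
  · simp only [h, true_iff] at h1 h2 ⊢; omega
  · simp only [h, false_iff] at h1 h2 ⊢; omega

theorem hook_eq {μ : YoungDiagram} {a b : ℕ} (h : (a, b) ∈ μ) :
    (μ.hook a b : ℤ) = (μ.rowLen a - a - 1) - (b - μ.colLen b) := by
  have h1 : b < μ.rowLen a := mem_iff_lt_rowLen.1 h
  have h2 : a < μ.colLen b := mem_iff_lt_colLen.1 h
  unfold hook
  omega

theorem dvd_hook_iff {μ : YoungDiagram} {ℓ a b : ℕ} (h : (a, b) ∈ μ) :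
    ℓ ∣ μ.hook a b ↔ (ℓ : ℤ) ∣ (μ.rowLen a - a - 1) - (b - μ.colLen b) := by
  rw [← hook_eq h, Int.natCast_dvd_natCast]

end YoungDiagram

open YoungDiagram

theorem isJM_iff_beads {ℓ : ℕ} {μ : YoungDiagram} :
    IsJM ℓ μ ↔ ∀ β γ β' γ' : ℤ, μ.Bead β → ¬ μ.Bead γ → μ.Bead β' → ¬ μ.Bead γ' →
      γ < β → γ' < β → γ < β' → (ℓ : ℤ) ∣ β - γ → ¬ (ℓ : ℤ) ∣ β - γ' →
      (ℓ : ℤ) ∣ β' - γ := by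
  constructor
  · intro h β γ β' γ' hβ hγ hβ' hγ' h1 h2 h3 h4 h5
    by_contra h6
    obtain ⟨a, rfl⟩ := hβ.exists_rowLen
    obtain ⟨b, rfl⟩ := exists_colLen_of_not_bead hγ
    obtain ⟨x, rfl⟩ := hβ'.exists_rowLen
    obtain ⟨y, rfl⟩ := exists_colLen_of_not_bead hγ'
    rw [← mem_iff_colLen_lt_rowLen] at h1 h2 h3
    exact h ⟨a, b, y, x, h1, h2, h3, (dvd_hook_iff h1).2 h4, (dvd_hook_iff h2).not.2 h5,
      (dvd_hook_iff h3).not.2 h6⟩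
  · rintro h ⟨a, b, y, x, h1, h2, h3, h4, h5, h6⟩
    rw [dvd_hook_iff h1] at h4
    rw [dvd_hook_iff h2] at h5
    rw [dvd_hook_iff h3] at h6
    rw [mem_iff_colLen_lt_rowLen] at h1 h2 h3
    exact h6 (h _ _ _ _ (μ.bead_rowLen a) (μ.not_bead_colLen b) (μ.bead_rowLen x)
      (μ.not_bead_colLen y) h1 h2 h3 h4 h5)

/-- `R` consists of one cell of the rim of `μ` for each content in `(k - ℓ, k]`. -/
structure IsRimSegment (ℓ : ℕ) (μ : YoungDiagram) (k : ℤ) (R : Finset (ℕ × ℕ)) : Prop where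
  mem_iff (i j : ℕ) : (i, j) ∈ R ↔
    (k - ℓ < (j : ℤ) - i ∧ (j : ℤ) - i ≤ k) ∧ (i : ℤ) = μ.rim (j - i) - 1
  exists_mem (c : ℤ) : k - ℓ < c → c ≤ k →
    ∃ i j : ℕ, (i, j) ∈ R ∧ (i : ℤ) = μ.rim c - 1 ∧ (j : ℤ) = μ.rim c - 1 + c

theorem cellAdj_content {u v : ℕ × ℕ} (h : CellAdj u v) :
    (v.2 : ℤ) - v.1 = u.2 - u.1 + 1 ∨ (v.2 : ℤ) - v.1 = u.2 - u.1 - 1 := by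
  unfold CellAdj at h
  omega

theorem CellAdj.symm {u v : ℕ × ℕ} (h : CellAdj u v) : CellAdj v u := by
  unfold CellAdj at *
  omega

theorem ConnectedSet.exists_content {R : Finset (ℕ × ℕ)} (hR : ConnectedSet R) {u v : ℕ × ℕ}
    (hu : u ∈ R) (hv : v ∈ R) {c : ℤ} (hc : (u.2 : ℤ) - u.1 ≤ c) (hc' : c ≤ v.2 - v.1) :
    ∃ w ∈ R, (w.2 : ℤ) - w.1 = c := by
  have key : ∀ w, Relation.ReflTransGen (fun x y : ℕ × ℕ => x ∈ R ∧ y ∈ R ∧ CellAdj x y) u w →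
      c ≤ w.2 - w.1 → ∃ w ∈ R, (w.2 : ℤ) - w.1 = c := by
    intro w hw
    induction hw with
    | refl => exact fun h => ⟨u, hu, by omega⟩
    | @tail x y _ hxy ih =>
      intro h
      by_cases hx : c ≤ (x.2 : ℤ) - x.1
      · exact ih hx
      · have := cellAdj_content hxy.2.2
        exact ⟨y, hxy.2.1, by omega⟩
  exact key v (hR u hu v hv) hc'

theorem IsRimHook.eq_rim {ℓ : ℕ} {μ : YoungDiagram} {R : Finset (ℕ × ℕ)}
    (hR : IsRimHook ℓ μ R) {i j : ℕ} (h : (i, j) ∈ R) : (i : ℤ) = μ.rim (j - i) - 1 := by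
  obtain ⟨hsub, -, ⟨ν, hν⟩, -, hsq⟩ := hR
  have hmem : (i, j) ∈ μ := hsub h
  have hν' : ∀ x y : ℕ, (x, y) ∈ ν ↔ (x, y) ∈ μ ∧ (x, y) ∉ R := fun x y => by
    rw [← YoungDiagram.mem_cells, hν, Finset.mem_sdiff, YoungDiagram.mem_cells]
  have hnot : (i + 1, j + 1) ∉ μ := by
    intro h11
    have aux : ∀ x y, i ≤ x → x ≤ i + 1 → j ≤ y → y ≤ j + 1 → (x, y) ∈ R := by
      intro x y hx hx' hy hy'
      by_contra hxy
      have : (x, y) ∈ ν := (hν' x y).2 ⟨μ.up_left_mem hx' hy' h11, hxy⟩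
      exact ((hν' i j).1 (ν.up_left_mem hx hy this)).2 h
    exact hsq ⟨i, j, h, aux _ _ (by omega) (by omega) (by omega) (by omega),
      aux _ _ (by omega) (by omega) (by omega) (by omega),
      aux _ _ (by omega) (by omega) (by omega) (by omega)⟩
  rw [mem_iff_lt_rim] at hmem hnot
  push_cast at hnot
  rw [add_sub_add_right_eq_sub] at hnot
  omega

theorem IsRimHook.exists_isRimSegment {ℓ : ℕ} (hℓ : 0 < ℓ) {μ : YoungDiagram}
    {R : Finset (ℕ × ℕ)} (hR : IsRimHook ℓ μ R) : ∃ k : ℤ, IsRimSegment ℓ μ k R := by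
  classical
  obtain ⟨-, hcard, -, hconn, -⟩ := id hR
  set C : Finset ℤ := R.image fun x => (x.2 : ℤ) - x.1 with hC
  have hCcard : C.card = ℓ := by
    rw [hC, Finset.card_image_of_injOn, hcard]
    rintro ⟨i, j⟩ hij ⟨i', j'⟩ hij' heq
    have h1 := hR.eq_rim hij
    have h2 := hR.eq_rim hij'
    simp only at heq
    rw [heq] at h1
    ext <;> simp only <;> omega
  have hne : C.Nonempty := Finset.card_pos.1 (by omega)
  obtain ⟨u, hu, hu'⟩ := Finset.mem_image.1 (C.min'_mem hne)
  obtain ⟨v, hv, hv'⟩ := Finset.mem_image.1 (C.max'_mem hne)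
  have hIcc : C = Finset.Icc (C.min' hne) (C.max' hne) := by
    ext c
    rw [Finset.mem_Icc]
    refine ⟨fun h => ⟨C.min'_le _ h, C.le_max' _ h⟩, fun h => ?_⟩
    obtain ⟨w, hw, hwc⟩ := hconn.exists_content hu hv (c := c) (by omega) (by omega)
    exact Finset.mem_image.2 ⟨w, hw, hwc⟩
  have hlen := congrArg Finset.card hIcc
  rw [hCcard, Int.card_Icc] at hlen
  have hmin : C.min' hne = C.max' hne - ℓ + 1 := by omega
  have hmemC : ∀ c, c ∈ C ↔ C.max' hne - ℓ < c ∧ c ≤ C.max' hne := fun c => by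
    conv_lhs => rw [hIcc]
    rw [Finset.mem_Icc]
    omega
  have hex : ∀ c : ℤ, C.max' hne - ℓ < c → c ≤ C.max' hne →
      ∃ i j : ℕ, (i, j) ∈ R ∧ (i : ℤ) = μ.rim c - 1 ∧ (j : ℤ) = μ.rim c - 1 + c := by
    intro c h h'
    obtain ⟨⟨i, j⟩, hw, hwc⟩ := Finset.mem_image.1 ((hmemC _).2 ⟨h, h'⟩)
    have := hR.eq_rim hw
    simp only at hwc
    rw [hwc] at this
    exact ⟨i, j, hw, this, by omega⟩
  refine ⟨C.max' hne, fun i j => ⟨fun h => ⟨?_, hR.eq_rim h⟩, fun ⟨h, h'⟩ => ?_⟩, hex⟩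
  · exact (hmemC _).1 (Finset.mem_image.2 ⟨_, h, rfl⟩)
  · obtain ⟨i', j', hw, hi, hj⟩ := hex _ h.1 h.2
    obtain rfl : i' = i := by omega
    obtain rfl : j' = j := by omega
    exact hw

namespace IsRimSegment

variable {ℓ : ℕ} {μ ν : YoungDiagram} {k : ℤ} {R : Finset (ℕ × ℕ)}

theorem rim_sdiff (hR : IsRimSegment ℓ μ k R) (hν : ν.cells = μ.cells \ R) (c : ℤ) :
    ν.rim c = if k - ℓ < c ∧ c ≤ k then μ.rim c - 1 else μ.rim c := by
  have hν' : ∀ x y : ℕ, (x, y) ∈ ν ↔ (x, y) ∈ μ ∧ (x, y) ∉ R := fun x y => by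
    rw [← YoungDiagram.mem_cells, hν, Finset.mem_sdiff, YoungDiagram.mem_cells]
  have hpos := μ.rim_nonneg c
  have hpos' := μ.rim_add_nonneg c
  have hpos2 : k - ℓ < c → c ≤ k → 1 ≤ μ.rim c ∧ 1 ≤ μ.rim c + c := fun h h' => by
    obtain ⟨i, j, -, hi, hj⟩ := hR.exists_mem c h h'
    omega
  refine rim_eq_of_forall fun i => ?_
  by_cases h : i < 0 ∨ i + c < 0
  · have : ν.Ext i (i + c) := by unfold YoungDiagram.Ext; tauto
    simp only [this, true_iff]
    split_ifs <;> omega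
  · push Not at h
    obtain ⟨a, rfl⟩ := Int.eq_ofNat_of_zero_le h.1
    obtain ⟨b, hb⟩ := Int.eq_ofNat_of_zero_le h.2
    obtain rfl : c = b - a := by omega
    rw [hb, ext_natCast, hν', hR.mem_iff, mem_iff_lt_rim]
    split_ifs <;> omega

theorem bead_and_not_bead (hR : IsRimSegment ℓ μ k R) (hℓ : 0 < ℓ)
    (hν : ν.cells = μ.cells \ R) : μ.Bead k ∧ ¬ μ.Bead (k - ℓ) := by
  have h1 := hR.rim_sdiff hν k
  have h2 := hR.rim_sdiff hν (k + 1)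
  have h3 := hR.rim_sdiff hν (k - ℓ)
  have h4 := hR.rim_sdiff hν (k - ℓ + 1)
  have h5 := ν.rim_succ_le k
  have h6 := μ.rim_le_succ k
  have h7 := ν.rim_le_succ (k - ℓ)
  have h8 := μ.rim_succ_le (k - ℓ)
  rw [if_pos (by omega)] at h1 h4
  rw [if_neg (by omega)] at h2 h3
  unfold Bead
  omega

theorem bead_sdiff_iff (hR : IsRimSegment ℓ μ k R) (hℓ : 0 < ℓ) (hν : ν.cells = μ.cells \ R)
    (c : ℤ) : ν.Bead c ↔ c = k - ℓ ∨ μ.Bead c ∧ c ≠ k := by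
  obtain ⟨hk, hk'⟩ := hR.bead_and_not_bead hℓ hν
  have h1 := hR.rim_sdiff hν c
  have h2 := hR.rim_sdiff hν (c + 1)
  rw [not_bead_iff] at hk'
  unfold Bead at *
  by_cases hc : c = k
  · subst hc
    rw [if_pos (by omega)] at h1
    rw [if_neg (by omega)] at h2
    omega
  by_cases hc' : c = k - ℓ
  · subst hc'
    rw [if_neg (by omega)] at h1
    rw [if_pos (by omega)] at h2
    omega
  split_ifs at h1 h2 <;> omega

theorem horizontal_iff (hR : IsRimSegment ℓ μ k R) (hℓ : 0 < ℓ) :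
    Horizontal R ↔ ∀ c, k - ℓ < c → c < k → ¬ μ.Bead c := by
  constructor
  · rintro ⟨r, hr⟩ c hc hc'
    obtain ⟨i, j, hij, hi, -⟩ := hR.exists_mem c hc hc'.le
    obtain ⟨i', j', hij', hi', -⟩ := hR.exists_mem (c + 1) (by omega) (by omega)
    have h1 := hr _ hij
    have h2 := hr _ hij'
    rw [not_bead_iff]
    simp only at h1 h2
    omega
  · intro h
    obtain ⟨r, -, -, hr, -⟩ := hR.exists_mem k (by omega) le_rfl
    have key : ∀ n : ℕ, n < ℓ → μ.rim (k - n) = μ.rim k := by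
      intro n
      induction n with
      | zero => simp
      | succ n ih =>
        intro hn
        have := not_bead_iff.1 (h (k - (n + 1 : ℕ)) (by omega) (by omega))
        rw [this, ← ih (by omega)]
        congr 1
        push_cast
        ring
    refine ⟨r, fun ⟨i, j⟩ hij => ?_⟩
    rw [hR.mem_iff] at hij
    have := key (k - (j - i)).toNat (by omega)
    rw [show k - ((k - (j - i)).toNat : ℤ) = j - i by omega] at this
    simp only
    omega

theorem vertical_iff (hR : IsRimSegment ℓ μ k R) (hℓ : 0 < ℓ) :
    Vertical R ↔ ∀ c, k - ℓ < c → c < k → μ.Bead c := by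
  constructor
  · rintro ⟨r, hr⟩ c hc hc'
    obtain ⟨i, j, hij, -, hj⟩ := hR.exists_mem c hc hc'.le
    obtain ⟨i', j', hij', -, hj'⟩ := hR.exists_mem (c + 1) (by omega) (by omega)
    have h1 := hr _ hij
    have h2 := hr _ hij'
    simp only at h1 h2
    unfold Bead
    omega
  · intro h
    obtain ⟨-, r, -, -, hr⟩ := hR.exists_mem k (by omega) le_rfl
    have key : ∀ n : ℕ, n < ℓ → μ.rim (k - n) + (k - n) = μ.rim k + k := by
      intro n
      induction n with
      | zero => simp
      | succ n ih =>
        intro hn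
        have h1 : μ.rim _ = _ := h (k - (n + 1 : ℕ)) (by omega) (by omega)
        rw [show k - ((n + 1 : ℕ) : ℤ) + 1 = k - n by push_cast; ring] at h1
        have := ih (by omega)
        push_cast at *
        omega
    refine ⟨r, fun ⟨i, j⟩ hij => ?_⟩
    rw [hR.mem_iff] at hij
    have := key (k - (j - i)).toNat (by omega)
    rw [show k - ((k - (j - i)).toNat : ℤ) = j - i by omega] at this
    simp only
    omega

theorem noSquare (hR : IsRimSegment ℓ μ k R) : NoSquare R := by
  rintro ⟨i, j, h, -, -, h'⟩
  rw [hR.mem_iff] at h h'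
  push_cast at h'
  rw [add_sub_add_right_eq_sub] at h'
  omega

theorem connectedSet (hR : IsRimSegment ℓ μ k R) : ConnectedSet R := by
  have : Std.Symm (fun x y : ℕ × ℕ => x ∈ R ∧ y ∈ R ∧ CellAdj x y) :=
    ⟨fun x y h => ⟨h.2.1, h.1, h.2.2.symm⟩⟩
  have key : ∀ (n : ℕ) (i j i' j' : ℕ), (i, j) ∈ R → (i', j') ∈ R →
      (j' : ℤ) - i' = j - i + n →
      Relation.ReflTransGen (fun x y : ℕ × ℕ => x ∈ R ∧ y ∈ R ∧ CellAdj x y) (i, j) (i', j') := by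
    intro n
    induction n with
    | zero =>
      intro i j i' j' h h' hc
      have h1 := ((hR.mem_iff _ _).1 h).2
      have h2 := ((hR.mem_iff _ _).1 h').2
      rw [show (j' : ℤ) - i' = j - i by omega] at h2
      obtain rfl : i' = i := by omega
      obtain rfl : j' = j := by omega
      exact .refl
    | succ n ih =>
      intro i j i' j' h h' hc
      have h1 := (hR.mem_iff _ _).1 h
      have h2 := (hR.mem_iff _ _).1 h'
      obtain ⟨x, y, hxy, hx, hy⟩ := hR.exists_mem (j - i + n) (by omega) (by omega)
      refine (ih i j x y h hxy (by omega)).tail ⟨hxy, h', ?_⟩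
      have h3 := μ.rim_succ_le (j - i + n)
      have h4 := μ.rim_le_succ (j - i + n)
      rw [hc] at h2
      push_cast at h2
      rw [← add_assoc] at h2
      unfold CellAdj
      simp only
      omega
  rintro ⟨i, j⟩ h ⟨i', j'⟩ h'
  rcases le_total ((j : ℤ) - i) (j' - i') with hle | hle
  · exact key ((j' - i') - (j - i) : ℤ).toNat i j i' j' h h' (by omega)
  · exact symm (key ((j - i) - (j' - i') : ℤ).toNat i' j' i j h' h (by omega))

theorem card_eq (hR : IsRimSegment ℓ μ k R) : R.card = ℓ := by
  have : (R.image fun x => (x.2 : ℤ) - x.1) = Finset.Ioc (k - ℓ) k := by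
    ext c
    rw [Finset.mem_image, Finset.mem_Ioc]
    constructor
    · rintro ⟨⟨i, j⟩, hij, rfl⟩
      exact ((hR.mem_iff i j).1 hij).1
    · rintro ⟨h, h'⟩
      obtain ⟨i, j, hij, hi, hj⟩ := hR.exists_mem c h h'
      exact ⟨(i, j), hij, by simp only; omega⟩
  have hcard := congrArg Finset.card this
  rw [Int.card_Ioc, Finset.card_image_of_injOn] at hcard
  · omega
  rintro ⟨i, j⟩ hij ⟨i', j'⟩ hij' heq
  have h1 := ((hR.mem_iff _ _).1 hij).2
  have h2 := ((hR.mem_iff _ _).1 hij').2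
  simp only at heq
  rw [heq] at h1
  ext <;> simp only <;> omega

theorem exists_of_bead (hk : μ.Bead k) (hk' : ¬ μ.Bead (k - ℓ)) :
    ∃ R, IsRimSegment ℓ μ k R := by
  classical
  have hk : μ.rim k = μ.rim (k + 1) + 1 := hk
  rw [not_bead_iff] at hk'
  have hpos : ∀ c, k - ℓ < c → c ≤ k → 1 ≤ μ.rim c ∧ 1 ≤ μ.rim c + c := by
    intro c h h'
    have h1 := μ.rim_antitone h'
    have h2 := μ.rim_add_monotone (show k - ℓ + 1 ≤ c by omega)
    have h3 := μ.rim_nonneg (k + 1)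
    have h4 := μ.rim_add_nonneg (k - ℓ)
    simp only at h2
    omega
  have hmem : ∀ i j : ℕ, (i, j) ∈ (Finset.Ioc (k - ℓ) k).image
      (fun c => ((μ.rim c - 1).toNat, (μ.rim c - 1 + c).toNat)) ↔
      (k - ℓ < (j : ℤ) - i ∧ (j : ℤ) - i ≤ k) ∧ (i : ℤ) = μ.rim (j - i) - 1 := by
    intro i j
    simp only [Finset.mem_image, Finset.mem_Ioc, Prod.mk.injEq]
    constructor
    · rintro ⟨c, ⟨h, h'⟩, hi, hj⟩
      have := hpos c h h'
      rw [show (j : ℤ) - i = c by omega]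
      omega
    · rintro ⟨h, h'⟩
      exact ⟨j - i, h, by omega, by omega⟩
  refine ⟨_, hmem, fun c h h' => ?_⟩
  have := hpos c h h'
  exact ⟨_, _, Finset.mem_image.2 ⟨c, Finset.mem_Ioc.2 ⟨h, h'⟩, rfl⟩, by omega, by omega⟩

theorem exists_sdiff (hR : IsRimSegment ℓ μ k R) (hk : μ.Bead k) (hk' : ¬ μ.Bead (k - ℓ)) :
    ∃ ν : YoungDiagram, ν.cells = μ.cells \ R := by
  have hk : μ.rim k = μ.rim (k + 1) + 1 := hk
  rw [not_bead_iff] at hk'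
  refine ⟨⟨μ.cells \ R, ?_⟩, rfl⟩
  rintro ⟨i, j⟩ ⟨i', j'⟩ ⟨hi, hj⟩ h
  simp only at hi hj
  simp only [Finset.coe_sdiff, Set.mem_sdiff, Finset.mem_coe, YoungDiagram.mem_cells] at h ⊢
  refine ⟨μ.up_left_mem hi hj h.1, fun h' => h.2 ?_⟩
  rw [hR.mem_iff] at h' ⊢
  have hμ := mem_iff_lt_rim.1 h.1
  rcases le_total ((j' : ℤ) - i') (j - i) with hle | hle
  · have h1 := μ.rim_antitone hle
    refine ⟨⟨by omega, ?_⟩, by omega⟩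
    by_contra hc
    have h2 := μ.rim_antitone (show k + 1 ≤ (j : ℤ) - i by omega)
    have h3 := μ.rim_antitone h'.1.2
    omega
  · have h1 := μ.rim_add_monotone hle
    simp only at h1
    refine ⟨⟨?_, by omega⟩, by omega⟩
    by_contra hc
    have h2 := μ.rim_add_monotone (show (j : ℤ) - i ≤ k - ℓ by omega)
    have h3 := μ.rim_add_monotone (show k - ℓ + 1 ≤ (j' : ℤ) - i' by omega)
    simp only at h2 h3
    omega

theorem isRimHook (hR : IsRimSegment ℓ μ k R) (hν : ν.cells = μ.cells \ R) :
    IsRimHook ℓ μ R := by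
  refine ⟨fun ⟨i, j⟩ h => ?_, hR.card_eq, ⟨ν, hν⟩, hR.connectedSet, hR.noSquare⟩
  rw [hR.mem_iff] at h
  rw [YoungDiagram.mem_cells, mem_iff_lt_rim]
  omega

end IsRimSegment

theorem exists_isRimHook_of_bead {ℓ : ℕ} {μ : YoungDiagram} {k : ℤ} (hk : μ.Bead k)
    (hk' : ¬ μ.Bead (k - ℓ)) : ∃ (R : Finset (ℕ × ℕ)) (ν : YoungDiagram),
      IsRimHook ℓ μ R ∧ IsRimSegment ℓ μ k R ∧ ν.cells = μ.cells \ R := by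
  obtain ⟨R, hR⟩ := IsRimSegment.exists_of_bead hk hk'
  obtain ⟨ν, hν⟩ := hR.exists_sdiff hk hk'
  exact ⟨R, ν, hR.isRimHook hν, hR, hν⟩

theorem Int.not_natCast_dvd_of_pos_of_lt {ℓ : ℕ} {x : ℤ} (h0 : 0 < x) (hx : x < ℓ) :
    ¬ (ℓ : ℤ) ∣ x := fun h => by
  have := Int.le_of_dvd h0 h
  omega

theorem IsJM.sdiff {ℓ : ℕ} (hℓ : 0 < ℓ) {μ ν : YoungDiagram} (h : IsJM ℓ μ)
    {R : Finset (ℕ × ℕ)} (hR : IsRimHook ℓ μ R) (hν : ν.cells = μ.cells \ R) : IsJM ℓ ν := by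
  obtain ⟨k, hk⟩ := hR.exists_isRimSegment hℓ
  obtain ⟨hb, hg⟩ := hk.bead_and_not_bead hℓ hν
  have hν := hk.bead_sdiff_iff hℓ hν
  have up : ∀ β, ν.Bead β → ∃ b, β ≤ b ∧ (ℓ : ℤ) ∣ b - β ∧ μ.Bead b := by
    intro β hβ
    rcases (hν β).1 hβ with rfl | hβ
    · exact ⟨k, by omega, by simp, hb⟩
    · exact ⟨β, le_rfl, by simp, hβ.1⟩
  have down : ∀ γ, ¬ ν.Bead γ → ∃ g, g ≤ γ ∧ (ℓ : ℤ) ∣ γ - g ∧ ¬ μ.Bead g := by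
    intro γ hγ
    rw [hν] at hγ
    by_cases hk : γ = k
    · exact ⟨k - ℓ, by omega, by simp [hk], hg⟩
    · exact ⟨γ, le_rfl, by simp, fun h => hγ (Or.inr ⟨h, hk⟩)⟩
  have trans : ∀ {β b γ g : ℤ}, (ℓ : ℤ) ∣ b - β → (ℓ : ℤ) ∣ γ - g →
      ((ℓ : ℤ) ∣ b - g ↔ (ℓ : ℤ) ∣ β - γ) := fun {β b γ g} h h' => by
    refine dvd_iff_dvd_of_dvd_sub ?_
    rw [show b - g - (β - γ) = b - β + (γ - g) by ring]
    exact dvd_add h h'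
  rw [isJM_iff_beads] at h ⊢
  intro β γ β' γ' hβ hγ hβ' hγ' h1 h2 h3 h4 h5
  obtain ⟨b, hb1, hb2, hb3⟩ := up β hβ
  obtain ⟨b', hb1', hb2', hb3'⟩ := up β' hβ'
  obtain ⟨g, hg1, hg2, hg3⟩ := down γ hγ
  obtain ⟨g', hg1', hg2', hg3'⟩ := down γ' hγ'
  exact (trans hb2' hg2).1 (h b g b' g' hb3 hg3 hb3' hg3' (by omega) (by omega) (by omega)
    ((trans hb2 hg2).2 h4) ((trans hb2 hg2').not.2 h5))

theorem IsJM.horizontal_or_vertical {ℓ : ℕ} (hℓ : 0 < ℓ) {μ : YoungDiagram} (h : IsJM ℓ μ)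
    {R : Finset (ℕ × ℕ)} (hR : IsRimHook ℓ μ R) : Horizontal R ∨ Vertical R := by
  obtain ⟨k, hk⟩ := hR.exists_isRimSegment hℓ
  obtain ⟨ν, hν⟩ := hR.2.2.1
  obtain ⟨hb, hg⟩ := hk.bead_and_not_bead hℓ hν
  rw [hk.horizontal_iff hℓ, hk.vertical_iff hℓ]
  rw [isJM_iff_beads] at h
  by_contra! hc
  obtain ⟨⟨b, hb1, hb2, hb3⟩, g, hg1, hg2, hg3⟩ := hc
  exact Int.not_natCast_dvd_of_pos_of_lt (by omega) (by omega)
    (h k (k - ℓ) b g hb hg hb3 hg3 (by omega) hg2 hb1 (by simp)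
      (Int.not_natCast_dvd_of_pos_of_lt (by omega) (by omega)))

theorem IsJM.not_adjSets {ℓ : ℕ} (hℓ : 2 < ℓ) {μ ν : YoungDiagram} (h : IsJM ℓ μ)
    {R S : Finset (ℕ × ℕ)} (hR : IsRimHook ℓ μ R) (hν : ν.cells = μ.cells \ R)
    (hS : IsRimHook ℓ ν S) (hRS : (Vertical R ∧ Horizontal S) ∨ (Horizontal R ∧ Vertical S)) :
    ¬ AdjSets R S := by
  have h0 : 0 < ℓ := by omega
  obtain ⟨k, hk⟩ := hR.exists_isRimSegment h0
  obtain ⟨k', hk'⟩ := hS.exists_isRimSegment h0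
  obtain ⟨ξ, hξ⟩ := hS.2.2.1
  obtain ⟨hb, hg⟩ := hk.bead_and_not_bead h0 hν
  obtain ⟨hb', hg'⟩ := hk'.bead_and_not_bead h0 hξ
  have hν := hk.bead_sdiff_iff h0 hν
  rw [hk.horizontal_iff h0, hk.vertical_iff h0, hk'.horizontal_iff h0, hk'.vertical_iff h0] at hRS
  rw [isJM_iff_beads] at h
  rintro ⟨⟨i, j⟩, hij, ⟨i', j'⟩, hij', hadj⟩
  have hadj := cellAdj_content hadj
  have hc := ((hk.mem_iff _ _).1 hij).1
  have hc' := ((hk'.mem_iff _ _).1 hij').1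
  simp only at hadj
  have hle : k' ≤ k + ℓ := by omega
  have hge : k - ℓ ≤ k' := by omega
  have hne : k' ≠ k := by
    rintro rfl
    rw [hν] at hb'
    omega
  have n1 : ¬ (ℓ : ℤ) ∣ 1 := Int.not_natCast_dvd_of_pos_of_lt (by omega) (by omega)
  have nsub : ∀ x : ℤ, (ℓ : ℤ) ∣ x → ¬ (ℓ : ℤ) ∣ x + 1 := fun x hx hx1 =>
    n1 ((Int.dvd_add_right hx).1 hx1)
  have two : (ℓ : ℤ) ∣ 2 * ℓ := dvd_mul_left _ _
  have no : ∀ β γ β' γ' : ℤ, μ.Bead β → ¬ μ.Bead γ → μ.Bead β' → ¬ μ.Bead γ' →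
      γ < β → γ' < β → γ < β' → (ℓ : ℤ) ∣ β - γ →
      ((ℓ : ℤ) ∣ β - γ' - 1 ∨ (ℓ : ℤ) ∣ β - γ' + 1) →
      ((ℓ : ℤ) ∣ β' - γ - 1 ∨ (ℓ : ℤ) ∣ β' - γ + 1) → False := by
    intro β γ β' γ' h1 h2 h3 h4 h5 h6 h7 h8 h9 h10
    have := h β γ β' γ' h1 h2 h3 h4 h5 h6 h7 h8 (fun hd => by
      rcases h9 with h9 | h9
      · exact nsub _ h9 (by rwa [sub_add_cancel])
      · exact nsub _ hd h9)
    rcases h10 with h10 | h10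
    · exact nsub _ h10 (by rwa [sub_add_cancel])
    · exact nsub _ this h10
  have hkν : ¬ ν.Bead k := by rw [hν]; omega
  have hkν' : ν.Bead (k - ℓ) := by rw [hν]; omega
  have bead_of_ne : ∀ c, ν.Bead c → c ≠ k - ℓ → μ.Bead c := fun c hc hne =>
    (((hν c).1 hc).resolve_left hne).1
  have gap_of_ne : ∀ c, ¬ ν.Bead c → c ≠ k → ¬ μ.Bead c := fun c hc hne hc' =>
    hc ((hν c).2 (Or.inr ⟨hc', hne⟩))
  rcases hRS with ⟨hV, hH⟩ | ⟨hH, hV⟩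
  · rcases lt_or_gt_of_ne hne with hlt | hlt
    · rcases hge.lt_or_eq with hlt' | rfl
      · exact hH (k - ℓ) (by omega) hlt' hkν'
      · exact no k (k - ℓ) (k - 1) (k - ℓ - 1) hb hg (hV _ (by omega) (by omega))
          (gap_of_ne _ (hH _ (by omega) (by omega)) (by omega)) (by omega) (by omega) (by omega)
          (by ring_nf; rfl) (Or.inl (by ring_nf; rfl)) (Or.inr (by ring_nf; rfl))
    · have hb1 : μ.Bead (k - 1) := hV _ (by omega) (by omega)
      rcases hle.lt_or_eq with hlt' | rfl
      · have hb2 : ν.Bead (k - 1) := (hν _).2 (Or.inr ⟨hb1, by omega⟩)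
        by_cases hc : k' - ℓ = k - 1
        · rw [hc] at hg'
          exact hg' hb2
        · exact hH (k - 1) (by omega) (by omega) hb2
      · exact no (k + ℓ) (k - ℓ) (k - 1) (k + 1) (bead_of_ne _ hb' (by omega)) hg hb1
          (gap_of_ne _ (hH _ (by omega) (by omega)) (by omega)) (by omega) (by omega) (by omega)
          (by ring_nf; rwa [mul_comm]) (Or.inr (by ring_nf; rfl)) (Or.inr (by ring_nf; rfl))
  · rcases lt_or_gt_of_ne hne with hlt | hlt
    · rcases hge.lt_or_eq with hlt' | rfl
      · exact hH k' hlt' hlt (bead_of_ne _ hb' (by omega))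
      · exact no k (k - ℓ - ℓ) (k - ℓ - 1) (k - 1) hb (gap_of_ne _ hg' (by omega))
          (bead_of_ne _ (hV _ (by omega) (by omega)) (by omega))
          (hH _ (by omega) (by omega)) (by omega) (by omega) (by omega)
          (by ring_nf; rwa [mul_comm]) (Or.inl (by ring_nf; exact dvd_zero _))
          (Or.inr (by ring_nf; rfl))
    · rcases hle.lt_or_eq with hlt' | rfl
      · exact hkν (hV k (by omega) hlt)
      · exact no (k + ℓ) (k - ℓ) (k + 1) (k - 1) (bead_of_ne _ hb' (by omega)) hg
          (bead_of_ne _ (hV _ (by omega) (by omega)) (by omega))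
          (hH _ (by omega) (by omega)) (by omega) (by omega) (by omega)
          (by ring_nf; rwa [mul_comm]) (Or.inl (by ring_nf; rfl)) (Or.inl (by ring_nf; rfl))

theorem IsJM.isGenLPartition {ℓ : ℕ} (hℓ : 2 < ℓ) {μ : YoungDiagram} (h : IsJM ℓ μ) :
    IsGenLPartition ℓ μ := by
  intro m hm
  have hJM : IsJM ℓ m := by
    induction hm with
    | refl => exact h
    | tail _ hstep ih =>
      obtain ⟨R, hR, -, hν⟩ := hstep
      exact ih.sdiff (by omega) hR hν
  exact ⟨fun R hR => hJM.horizontal_or_vertical (by omega) hR,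
    fun R hR m' hm' S hS hRS => hJM.not_adjSets hℓ hR hm' hS hRS⟩

namespace IsGenLPartition

variable {ℓ : ℕ} {μ : YoungDiagram}

theorem forall_bead_or_forall_not_bead (hμ : IsGenLPartition ℓ μ) (hℓ : 0 < ℓ) {k : ℤ}
    (hk : μ.Bead k) (hk' : ¬ μ.Bead (k - ℓ)) :
    (∀ c, k - ℓ < c → c < k → μ.Bead c) ∨ (∀ c, k - ℓ < c → c < k → ¬ μ.Bead c) := by
  obtain ⟨R, ν, hR, hseg, -⟩ := exists_isRimHook_of_bead hk hk'
  have := (hμ μ .refl).1 R hR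
  rwa [hseg.horizontal_iff hℓ, hseg.vertical_iff hℓ, or_comm] at this

theorem exists_move (hμ : IsGenLPartition ℓ μ) (hℓ : 0 < ℓ) {k : ℤ} (hk : μ.Bead k)
    (hk' : ¬ μ.Bead (k - ℓ)) :
    ∃ ν, IsGenLPartition ℓ ν ∧ ∀ c, ν.Bead c ↔ c = k - ℓ ∨ μ.Bead c ∧ c ≠ k := by
  obtain ⟨R, ν, hR, hseg, hν⟩ := exists_isRimHook_of_bead hk hk'
  exact ⟨ν, fun m hm => hμ m (hm.head ⟨R, hR, (hμ μ .refl).1 R hR, hν⟩),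
    hseg.bead_sdiff_iff hℓ hν⟩

theorem exists_bead_move (hℓ : 0 < ℓ) (n : ℕ) : ∀ {μ : YoungDiagram} {t : ℤ},
    IsGenLPartition ℓ μ → μ.Bead (t + n * ℓ) → ∃ ν, IsGenLPartition ℓ ν ∧ ν.Bead t ∧
      ∀ c, c < t ∨ ¬ (ℓ : ℤ) ∣ c - t → (ν.Bead c ↔ μ.Bead c) := by
  induction n with
  | zero => exact fun hμ hb => ⟨_, hμ, by simpa using hb, fun _ _ => Iff.rfl⟩
  | succ n ih =>
    intro μ t hμ hb
    have hdvd : ∀ c, ¬ (ℓ : ℤ) ∣ c - t → ¬ (ℓ : ℤ) ∣ c - (t + ℓ) := fun c hc hd =>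
      hc (by simpa [sub_add_eq_sub_sub] using hd)
    obtain ⟨ν, hν, hbν, hsame⟩ := ih (t := t + ℓ) hμ (by
      convert hb using 1; push_cast; ring)
    by_cases ht : ν.Bead t
    · exact ⟨ν, hν, ht, fun c hc => hsame c (hc.imp (by omega) (hdvd c))⟩
    · obtain ⟨ξ, hξ, hξ'⟩ := hν.exists_move hℓ hbν (by rwa [add_sub_cancel_right])
      refine ⟨ξ, hξ, by rw [hξ']; simp, fun c hc => ?_⟩
      rw [hξ', ← hsame c (hc.imp (by omega) (hdvd c)), add_sub_cancel_right]
      have h1 : c ≠ t := by rintro rfl; simp at hc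
      have h2 : c ≠ t + ℓ := by rintro rfl; simp at hc; omega
      tauto

theorem exists_gap_move (hℓ : 0 < ℓ) (n : ℕ) : ∀ {s : ℤ},
    IsGenLPartition ℓ μ → ¬ μ.Bead (s - n * ℓ) → ∃ ν, IsGenLPartition ℓ ν ∧ ¬ ν.Bead s ∧
      ∀ c, s < c ∨ ¬ (ℓ : ℤ) ∣ c - s → (ν.Bead c ↔ μ.Bead c) := by
  induction n with
  | zero => exact fun hμ hb => ⟨_, hμ, by simpa using hb, fun _ _ => Iff.rfl⟩
  | succ n ih =>
    intro s hμ hb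
    have hdvd : ∀ c, ¬ (ℓ : ℤ) ∣ c - s → ¬ (ℓ : ℤ) ∣ c - (s - ℓ) := fun c hc hd =>
      hc (by simpa [← sub_add] using hd)
    obtain ⟨ν, hν, hbν, hsame⟩ := ih (s := s - ℓ) hμ (by
      convert hb using 2; push_cast; ring)
    by_cases hs : ν.Bead s
    · obtain ⟨ξ, hξ, hξ'⟩ := hν.exists_move hℓ hs hbν
      refine ⟨ξ, hξ, by rw [hξ']; omega, fun c hc => ?_⟩
      rw [hξ', ← hsame c (hc.imp (by omega) (hdvd c))]
      have h1 : c ≠ s := by rintro rfl; simp at hc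
      have h2 : c ≠ s - ℓ := by rintro rfl; simp at hc; omega
      tauto
    · exact ⟨ν, hν, hs, fun c hc => hsame c (hc.imp (by omega) (hdvd c))⟩

theorem exists_bead_gap_move (hμ : IsGenLPartition ℓ μ) (hℓ : 0 < ℓ) {s t : ℤ} (n m : ℕ)
    (hst : s < t) (hd : (ℓ : ℤ) ∣ t - s) (ht : μ.Bead (t + n * ℓ)) (hs : ¬ μ.Bead (s - m * ℓ)) :
    ∃ ν, IsGenLPartition ℓ ν ∧ ν.Bead t ∧ ¬ ν.Bead s ∧
      ∀ c, ¬ (ℓ : ℤ) ∣ c - s → (ν.Bead c ↔ μ.Bead c) := by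
  obtain ⟨ν, hν, hνt, hν'⟩ := exists_bead_move hℓ n hμ ht
  have hnonneg : (0 : ℤ) ≤ m * ℓ := by positivity
  have hs' : ¬ ν.Bead (s - m * ℓ) := by
    rwa [hν' _ (Or.inl (by omega))]
  obtain ⟨ξ, hξ, hξs, hξ'⟩ := exists_gap_move hℓ m hν hs'
  refine ⟨ξ, hξ, (hξ' t (Or.inl hst)).2 hνt, hξs, fun c hc => ?_⟩
  rw [hξ' c (Or.inr hc), hν' c (Or.inr fun h => hc ?_)]
  rw [show c - s = c - t + (t - s) by ring]
  exact dvd_add h hd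

theorem not_opposite (hμ : IsGenLPartition ℓ μ) (hℓ : 0 < ℓ) {k : ℤ} (hk : μ.Bead (k + ℓ))
    (hk' : ¬ μ.Bead (k - ℓ)) :
    ¬ ((∀ c, k - ℓ < c → c < k → μ.Bead c) ∧ (∀ c, k < c → c < k + ℓ → ¬ μ.Bead c)) ∧
    ¬ ((∀ c, k - ℓ < c → c < k → ¬ μ.Bead c) ∧ (∀ c, k < c → c < k + ℓ → μ.Bead c)) := by
  by_cases hb : μ.Bead k
  · obtain ⟨R, ν, hR, hRseg, hν⟩ := exists_isRimHook_of_bead hb hk'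
    have hν' := hRseg.bead_sdiff_iff hℓ hν
    obtain ⟨S, -, hS, hSseg, -⟩ := exists_isRimHook_of_bead (ℓ := ℓ) (μ := ν) (k := k + ℓ)
      (by rw [hν']; exact Or.inr ⟨hk, by omega⟩) (by rw [hν']; omega)
    have hadj : AdjSets R S := by
      obtain ⟨i, j, hij, hi, hj⟩ := hRseg.exists_mem k (by omega) le_rfl
      obtain ⟨i', j', hij', hi', hj'⟩ := hSseg.exists_mem (k + 1) (by omega) (by omega)
      rw [hRseg.rim_sdiff hν, if_neg (by omega)] at hi' hj'
      have : μ.rim k = μ.rim (k + 1) + 1 := hb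
      exact ⟨_, hij, _, hij', by unfold CellAdj; simp only; omega⟩
    have key := mt ((hμ μ .refl).2 R hR ν hν S hS) (not_not_intro hadj)
    rw [hRseg.horizontal_iff hℓ, hRseg.vertical_iff hℓ, hSseg.horizontal_iff hℓ,
      hSseg.vertical_iff hℓ, add_sub_cancel_right] at key
    have hup : ∀ c, k < c → (ν.Bead c ↔ μ.Bead c) := fun c hc => by
      simp [hν', hc.ne', show c ≠ k - ℓ by omega]
    refine ⟨fun h => key (Or.inl ⟨h.1, fun c h1 h2 => ?_⟩),
      fun h => key (Or.inr ⟨h.1, fun c h1 h2 => ?_⟩)⟩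
    · rw [hup c h1]; exact h.2 c h1 h2
    · rw [hup c h1]; exact h.2 c h1 h2
  · obtain ⟨R, ν, hR, hRseg, hν⟩ := exists_isRimHook_of_bead (ℓ := ℓ) hk
      (by rwa [add_sub_cancel_right])
    have hν' := hRseg.bead_sdiff_iff hℓ hν
    rw [add_sub_cancel_right] at hν'
    obtain ⟨S, -, hS, hSseg, -⟩ := exists_isRimHook_of_bead (ℓ := ℓ) (μ := ν) (k := k)
      (by rw [hν']; exact Or.inl rfl) (by rw [hν']; rintro (h | h) <;> [omega; exact hk' h.1])
    have hadj : AdjSets R S := by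
      obtain ⟨i, j, hij, hi, hj⟩ := hRseg.exists_mem (k + 1) (by omega) (by omega)
      obtain ⟨i', j', hij', hi', hj'⟩ := hSseg.exists_mem k (by omega) le_rfl
      rw [hRseg.rim_sdiff hν, if_neg (by omega)] at hi' hj'
      have := not_bead_iff.1 hb
      exact ⟨_, hij, _, hij', by unfold CellAdj; simp only; omega⟩
    have key := mt ((hμ μ .refl).2 R hR ν hν S hS) (not_not_intro hadj)
    rw [hRseg.horizontal_iff hℓ, hRseg.vertical_iff hℓ, hSseg.horizontal_iff hℓ,
      hSseg.vertical_iff hℓ, add_sub_cancel_right] at key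
    have hlow : ∀ c, c < k → (ν.Bead c ↔ μ.Bead c) := fun c hc => by
      simp [hν', hc.ne, show c ≠ k + ℓ by omega]
    refine ⟨fun h => key (Or.inr ⟨h.2, fun c h1 h2 => ?_⟩),
      fun h => key (Or.inl ⟨h.2, fun c h1 h2 => ?_⟩)⟩
    · rw [hlow c h2]; exact h.1 c h1 h2
    · rw [hlow c h2]; exact h.1 c h1 h2

/-- Between a gap and a bead of the same residue, the positions of other residues are either all
beads or all gaps. -/
theorem forall_between (hμ : IsGenLPartition ℓ μ) (hℓ : 0 < ℓ) {y z : ℤ} (hy : μ.Bead y)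
    (hz : ¬ μ.Bead z) (hzy : z < y) (hd : (ℓ : ℤ) ∣ y - z) :
    (∀ c, z < c → c < y → ¬ (ℓ : ℤ) ∣ c - z → μ.Bead c) ∨
    (∀ c, z < c → c < y → ¬ (ℓ : ℤ) ∣ c - z → ¬ μ.Bead c) := by
  have hℓ' : (0 : ℤ) < ℓ := by exact_mod_cast hℓ
  obtain ⟨q, hq⟩ := hd
  obtain ⟨q, rfl⟩ : ∃ p : ℕ, q = p := Int.eq_ofNat_of_zero_le (by nlinarith)
  have notdvd : ∀ (m : ℕ) (c : ℤ), z + m * ℓ < c → c < z + m * ℓ + ℓ → ¬ (ℓ : ℤ) ∣ c - z := by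
    intro m c h1 h2 h
    refine Int.not_natCast_dvd_of_pos_of_lt (x := c - z - m * ℓ) (ℓ := ℓ) (by omega) (by omega) ?_
    exact dvd_sub h (dvd_mul_left _ _)
  have shift : ∀ (m : ℕ) {c : ℤ}, ¬ (ℓ : ℤ) ∣ c - z → ¬ (ℓ : ℤ) ∣ c - (z + m * ℓ) := by
    intro m c h h'
    apply h
    rw [show c - z = c - (z + m * ℓ) + m * ℓ by ring]
    exact dvd_add h' (dvd_mul_left _ _)
  have block : ∀ m : ℕ, m < q →
      (∀ c, z + m * ℓ < c → c < z + m * ℓ + ℓ → μ.Bead c) ∨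
      (∀ c, z + m * ℓ < c → c < z + m * ℓ + ℓ → ¬ μ.Bead c) := by
    intro m hm
    obtain ⟨p, rfl⟩ := Nat.exists_eq_add_of_lt hm
    obtain ⟨ν, hν, ht, hs, hsame⟩ := hμ.exists_bead_gap_move hℓ (s := z + m * ℓ)
      (t := z + m * ℓ + ℓ) p m (by omega) (by simp)
      (by convert hy using 1; push_cast at hq; linarith) (by simpa using hz)
    have h := hν.forall_bead_or_forall_not_bead hℓ ht (by rwa [add_sub_cancel_right])
    rw [add_sub_cancel_right] at h
    refine h.imp (fun h c h1 h2 => ?_) (fun h c h1 h2 => ?_)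
    · exact (hsame c (shift m (notdvd m c h1 h2))).1 (h c h1 h2)
    · exact (hsame c (shift m (notdvd m c h1 h2))).not.1 (h c h1 h2)
  have succ : ∀ m : ℕ, m + 1 < q →
      ¬ ((∀ c, z + m * ℓ < c → c < z + m * ℓ + ℓ → μ.Bead c) ∧
        (∀ c, z + m * ℓ + ℓ < c → c < z + m * ℓ + ℓ + ℓ → ¬ μ.Bead c)) ∧
      ¬ ((∀ c, z + m * ℓ < c → c < z + m * ℓ + ℓ → ¬ μ.Bead c) ∧
        (∀ c, z + m * ℓ + ℓ < c → c < z + m * ℓ + ℓ + ℓ → μ.Bead c)) := by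
    intro m hm
    obtain ⟨p, rfl⟩ := Nat.exists_eq_add_of_lt hm
    obtain ⟨ν, hν, ht, hs, hsame⟩ := hμ.exists_bead_gap_move hℓ (s := z + m * ℓ)
      (t := z + m * ℓ + ℓ + ℓ) p m (by omega)
      (by rw [add_assoc, add_sub_cancel_left]; exact dvd_add dvd_rfl dvd_rfl)
      (by convert hy using 1; push_cast at hq; linarith) (by simpa using hz)
    have h := hν.not_opposite hℓ ht (by rwa [add_sub_cancel_right])
    rw [add_sub_cancel_right] at h
    have low : ∀ c, z + m * ℓ < c → c < z + m * ℓ + ℓ → (ν.Bead c ↔ μ.Bead c) :=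
      fun c h1 h2 => hsame c (shift m (notdvd m c h1 h2))
    have high : ∀ c, z + m * ℓ + ℓ < c → c < z + m * ℓ + ℓ + ℓ → (ν.Bead c ↔ μ.Bead c) :=
      fun c h1 h2 => hsame c (shift m (notdvd (m + 1) c (by push_cast; linarith)
        (by push_cast; linarith)))
    refine ⟨fun h' => h.1 ⟨fun c h1 h2 => ?_, fun c h1 h2 => ?_⟩,
      fun h' => h.2 ⟨fun c h1 h2 => ?_, fun c h1 h2 => ?_⟩⟩
    · rw [low c h1 h2]; exact h'.1 c h1 h2
    · rw [high c h1 h2]; exact h'.2 c h1 h2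
    · rw [low c h1 h2]; exact h'.1 c h1 h2
    · rw [high c h1 h2]; exact h'.2 c h1 h2
  have cast_succ : ∀ m : ℕ, z + ((m + 1 : ℕ) : ℤ) * ℓ = z + m * ℓ + ℓ := fun m => by
    push_cast; ring
  have locate : ∀ c, z < c → c < y → ¬ (ℓ : ℤ) ∣ c - z →
      ∃ m : ℕ, m < q ∧ z + m * ℓ < c ∧ c < z + m * ℓ + ℓ := by
    intro c h1 h2 h3
    have e1 := Int.mul_ediv_add_emod (c - z) ℓ
    have e2 := Int.emod_lt_of_pos (c - z) hℓ'
    have e3 := Int.emod_nonneg (c - z) hℓ'.ne'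
    have e4 : (c - z) % ℓ ≠ 0 := fun h => h3 (Int.dvd_of_emod_eq_zero h)
    obtain ⟨m, hm⟩ := Int.eq_ofNat_of_zero_le (Int.ediv_nonneg (show 0 ≤ c - z by omega) hℓ'.le)
    rw [hm, mul_comm] at e1
    refine ⟨m, ?_, by omega, by omega⟩
    have : (m : ℤ) < q := by
      by_contra hc
      have := mul_le_mul_of_nonneg_right (not_lt.1 hc) hℓ'.le
      rw [mul_comm] at hq
      omega
    exact_mod_cast this
  rcases Nat.eq_zero_or_pos q with rfl | hq0
  · simp at hq; omega
  refine (block 0 hq0).imp (fun h0 => ?_) (fun h0 => ?_)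
  · have all : ∀ m : ℕ, m < q → ∀ c, z + m * ℓ < c → c < z + m * ℓ + ℓ → μ.Bead c := by
      intro m
      induction m with
      | zero => exact fun _ => h0
      | succ m ih =>
        intro hm
        refine (block (m + 1) hm).resolve_right fun h => ?_
        rw [cast_succ] at h
        exact (succ m hm).1 ⟨ih (by omega), h⟩
    intro c h1 h2 h3
    obtain ⟨m, hm, hm1, hm2⟩ := locate c h1 h2 h3
    exact all m hm c hm1 hm2
  · have all : ∀ m : ℕ, m < q → ∀ c, z + m * ℓ < c → c < z + m * ℓ + ℓ → ¬ μ.Bead c := by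
      intro m
      induction m with
      | zero => exact fun _ => h0
      | succ m ih =>
        intro hm
        refine (block (m + 1) hm).resolve_left fun h => ?_
        rw [cast_succ] at h
        exact (succ m hm).2 ⟨ih (by omega), h⟩
    intro c h1 h2 h3
    obtain ⟨m, hm, hm1, hm2⟩ := locate c h1 h2 h3
    exact all m hm c hm1 hm2

theorem isJM (hμ : IsGenLPartition ℓ μ) (hℓ : 2 < ℓ) : IsJM ℓ μ := by
  have h0 : 0 < ℓ := by omega
  have hℓ' : (0 : ℤ) < ℓ := by exact_mod_cast h0
  rw [isJM_iff_beads]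
  intro β γ β' γ' hβ hγ hβ' hγ' h1 h2 h3 h4 h5
  by_contra h6
  have hge : γ + ℓ ≤ β := by have := Int.le_of_dvd (by omega) h4; omega
  have nd : ∀ {x : ℤ} (z : ℤ), z < x → x < z + ℓ → ¬ (ℓ : ℤ) ∣ x - z := fun z hx hx' =>
    Int.not_natCast_dvd_of_pos_of_lt (by omega) (by omega)
  have nd' : ∀ {x y : ℤ} (z : ℤ), (ℓ : ℤ) ∣ y - z → x < y → y - ℓ < x → ¬ (ℓ : ℤ) ∣ x - z := by
    intro x y z hz hx hx' h
    refine Int.not_natCast_dvd_of_pos_of_lt (ℓ := ℓ) (x := y - x) (by omega) (by omega) ?_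
    rw [show y - x = y - z - (x - z) by ring]
    exact dvd_sub hz h
  have hγγ' : ¬ (ℓ : ℤ) ∣ γ' - γ := fun h => h5 (by
    rw [show β - γ' = β - γ - (γ' - γ) by ring]; exact dvd_sub h4 h)
  have hββ' : ¬ (ℓ : ℤ) ∣ β - β' := fun h => h6 (by
    rw [show β' - γ = β - γ - (β - β') by ring]; exact dvd_sub h4 h)
  rcases hμ.forall_between h0 hβ hγ h1 h4 with hall | hall
  · have hlt : γ' < γ := by
      by_contra hc
      rcases (not_lt.1 hc).lt_or_eq with hc | rfl
      · exact hγ' (hall γ' hc h2 hγγ')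
      · exact h5 h4
    have e2 := Int.emod_lt_of_pos (γ' - γ) hℓ'
    have e3 := Int.emod_nonneg (γ' - γ) hℓ'.ne'
    have e4 : (γ' - γ) % ℓ ≠ 0 := fun h => hγγ' (Int.dvd_of_emod_eq_zero h)
    obtain ⟨w, hw⟩ : ∃ w, w = γ + (γ' - γ) % ℓ := ⟨_, rfl⟩
    have hwd : (ℓ : ℤ) ∣ w - γ' := by
      have := dvd_neg.2 (Int.dvd_self_sub_emod (x := γ' - γ) (m := ℓ))
      rwa [show -(γ' - γ - (γ' - γ) % ℓ) = w - γ' by rw [hw]; ring] at this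
    have hwb : μ.Bead w := hall w (by omega) (by omega)
      (nd γ (by omega) (by omega))
    have hgaps := (hμ.forall_between h0 hwb hγ' (by omega) hwd).resolve_left fun h =>
      hγ (h γ hlt (by omega) (nd' γ' hwd (by omega) (by omega)))
    have hb1 : μ.Bead (γ + 1) := hall _ (by omega) (by omega)
      (nd γ (by omega) (by omega))
    have hw1 : w = γ + 1 := by
      by_contra hne
      exact hgaps (γ + 1) (by omega) (by omega) (nd' γ' hwd (by omega) (by omega)) hb1
    have hnd : ¬ (ℓ : ℤ) ∣ γ - 1 - γ' := nd' γ' hwd (by omega) (by omega)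
    have hg1 : ¬ μ.Bead (γ - 1) := by
      by_cases hc : γ - 1 = γ'
      · rwa [hc]
      · exact hgaps _ (by omega) (by omega) hnd
    have hb2 : μ.Bead (γ - 1 + ℓ) := hall _ (by omega) (by omega)
      (nd γ (by omega) (by omega))
    rcases hμ.forall_between h0 hb2 hg1 (by omega) (by simp) with h | h
    · exact hγ (h γ (by omega) (by omega) (nd _ (by omega) (by omega)))
    · exact h (γ + 1) (by omega) (by omega) (nd _ (by omega) (by omega)) hb1
  · have hlt : β < β' := by
      by_contra hc
      rcases (not_lt.1 hc).lt_or_eq with hc | rfl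
      · exact hall β' h3 hc h6 hβ'
      · exact h6 h4
    have e2 := Int.emod_lt_of_pos (β - β') hℓ'
    have e3 := Int.emod_nonneg (β - β') hℓ'.ne'
    have e4 : (β - β') % ℓ ≠ 0 := fun h => hββ' (Int.dvd_of_emod_eq_zero h)
    obtain ⟨w, hw⟩ : ∃ w, w = β - (β - β') % ℓ := ⟨_, rfl⟩
    have hwd : (ℓ : ℤ) ∣ β' - w := by
      have := dvd_neg.2 (Int.dvd_self_sub_emod (x := β - β') (m := ℓ))
      rwa [show -(β - β' - (β - β') % ℓ) = β' - w by rw [hw]; ring] at this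
    have hwb : ¬ μ.Bead w := hall w (by omega) (by omega)
      (nd' γ h4 (by omega) (by omega))
    have hbeads := (hμ.forall_between h0 hβ' hwb (by omega) hwd).resolve_right fun h =>
      h β (by omega) hlt (nd w (by omega) (by omega)) hβ
    have hb1 : ¬ μ.Bead (β - 1) := hall _ (by omega) (by omega)
      (nd' γ h4 (by omega) (by omega))
    have hw1 : w = β - 1 := by
      by_contra hne
      exact hb1 (hbeads (β - 1) (by omega) (by omega) (nd w (by omega) (by omega)))
    have hnd : ¬ (ℓ : ℤ) ∣ β + 1 - w := nd w (by omega) (by omega)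
    have hg1 : μ.Bead (β + 1) := by
      by_cases hc : β + 1 = β'
      · rwa [hc]
      · exact hbeads _ (by omega) (by omega) hnd
    have hb2 : ¬ μ.Bead (β + 1 - ℓ) := hall _ (by omega) (by omega)
      (nd' γ h4 (by omega) (by omega))
    rcases hμ.forall_between h0 hg1 hb2 (by omega) (by simp) with h | h
    · exact hb1 (h (β - 1) (by omega) (by omega) (nd _ (by omega) (by omega)))
    · exact h β (by omega) (by omega) (nd _ (by omega) (by omega)) hβ

end IsGenLPartition

/-- A partition is an `(ℓ,0)`-JM partition if and only if it is a generalized `ℓ`-partition. -/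
theorem isJM_iff_isGenLPartition (ℓ : ℕ) (hℓ : 2 < ℓ) (lam : YoungDiagram) :
    IsJM ℓ lam ↔ IsGenLPartition ℓ lam :=
  ⟨fun h => h.isGenLPartition hℓ, fun h => h.isJM hℓ⟩
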